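/- arXiv:2310.15902 — 2 statements merged into one kernel-verified Lean document; each statement's English description precedes it below -/
import Mathlib

section
/- If |X| ≥ d+2 and X satisfies the Δ-property (the simplex spanned by the first d+1 points of X equals the convex hull of X), then every simplex of the incremental Delaunay complex I(X) is a face of a (d+1)-dimensional simplex of I(X); in particular I(X) is pure of dimension d+1. -/
open Finset

def GenPos {d n : ℕ} (x : Fin n → EuclideanSpace ℝ (Fin d)) : Prop :=
  ∀ s : Finset (Fin n), s.Nonempty → s.card ≤ d + 1 →
    (AffineIndependent ℝ (fun i : s => x i)) ∧
    ∀ (c : EuclideanSpace ℝ (Fin d)) (r : ℝ),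
      ((∀ i ∈ s, dist (x i) c = r) ∧
        ∀ (c' : EuclideanSpace ℝ (Fin d)) (r' : ℝ),
          (∀ i ∈ s, dist (x i) c' = r') → r ≤ r') →
      ∀ j, j ∉ s → dist (x j) c ≠ r

/-- The Δ-property: the convex hull of all points equals the (geometric) simplex spanned by
the first `d+1` points. -/
def DeltaProp {d n : ℕ} (x : Fin n → EuclideanSpace ℝ (Fin d)) : Prop :=
  convexHull ℝ (Set.range x) = convexHull ℝ (x '' {i : Fin n | (i : ℕ) < d + 1})

/-- `σ` belongs to the incremental Delaunay complex `I(X)`. -/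
def IncrMem {d n : ℕ} (x : Fin n → EuclideanSpace ℝ (Fin d))
    (σ : Finset (Fin n)) : Prop :=
  ∃ h : σ.Nonempty, ∃ (c : EuclideanSpace ℝ (Fin d)) (r : ℝ),
    (∀ i ∈ σ.erase (σ.max' h), dist (x i) c = r) ∧
    dist (x (σ.max' h)) c ≤ r ∧
    ∀ i : Fin n, i < σ.max' h → r ≤ dist (x i) c

/-- If every direction that is non-decreasing for the functionals `ℓ i` is non-decreasing for `g`,
and the `ℓ i` have no common kernel, then a feasible point of the polyhedron `0 ≤ b i + ℓ i v` can
be moved, without increasing `g` or losing a tight constraint, to one with at least `dim V` tight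
constraints. -/
theorem exists_feasible_finrank_le_card_tight {V ι : Type*} [AddCommGroup V] [Module ℝ V]
    [FiniteDimensional ℝ V] (A : Finset ι) (ℓ : ι → V →ₗ[ℝ] ℝ) (b : ι → ℝ) (g : V →ₗ[ℝ] ℝ)
    (hker : ∀ v, v ≠ 0 → ∃ i ∈ A, ℓ i v ≠ 0)
    (hg : ∀ v, (∀ i ∈ A, 0 ≤ ℓ i v) → 0 ≤ g v)
    (v₀ : V) (hv₀ : ∀ i ∈ A, 0 ≤ b i + ℓ i v₀) :
    ∃ v, (∀ i ∈ A, 0 ≤ b i + ℓ i v) ∧ g v ≤ g v₀ ∧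
      (∀ i ∈ A, b i + ℓ i v₀ = 0 → b i + ℓ i v = 0) ∧
      Module.finrank ℝ V ≤ #{i ∈ A | b i + ℓ i v = 0} := by
  classical
  induction hk : #A - #{i ∈ A | b i + ℓ i v₀ = 0} using Nat.strong_induction_on
    generalizing v₀ with
  | _ k ih =>
  subst hk
  set T := {i ∈ A | b i + ℓ i v₀ = 0} with hT
  by_cases hc : Module.finrank ℝ V ≤ #T
  · exact ⟨v₀, hv₀, le_rfl, fun _ _ h => h, hc⟩
  obtain ⟨w, hwT, hgw, i₁, hi₁, hlt⟩ : ∃ w, (∀ i ∈ T, ℓ i w = 0) ∧ g w ≤ 0 ∧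
      ∃ i ∈ A, ℓ i w < 0 := by
    obtain ⟨u, hu, hu0⟩ := (LinearMap.ker (LinearMap.pi fun i : T => ℓ i)).ne_bot_iff.1
      (LinearMap.ker_ne_bot_of_finrank_lt (by simpa using hc))
    have huT : ∀ i ∈ T, ℓ i u = 0 := fun i hi => congrFun (LinearMap.mem_ker.1 hu) ⟨i, hi⟩
    obtain ⟨i, hi, hne⟩ := hker u hu0
    rcases lt_trichotomy (g u) 0 with h | h | h
    · refine ⟨u, huT, h.le, ?_⟩
      by_contra! hcon
      exact absurd (hg u hcon) (not_le.2 h)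
    · rcases lt_or_gt_of_ne hne with h' | h'
      · exact ⟨u, huT, h.le, i, hi, h'⟩
      · exact ⟨-u, fun j hj => by simp [huT j hj], by simp [h], i, hi, by simpa using h'⟩
    · refine ⟨-u, fun j hj => by simp [huT j hj], by simpa using h.le, ?_⟩
      by_contra! hcon
      have := hg (-u) hcon
      simp only [map_neg] at this
      linarith
  obtain ⟨i₀, hi₀, hmin⟩ := exists_min_image {i ∈ A | ℓ i w < 0}
    (fun i => (b i + ℓ i v₀) / (-ℓ i w)) ⟨i₁, mem_filter.2 ⟨hi₁, hlt⟩⟩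
  obtain ⟨hi₀A, hi₀w⟩ := mem_filter.1 hi₀
  set s := (b i₀ + ℓ i₀ v₀) / (-ℓ i₀ w) with hs
  have hs0 : 0 ≤ s := div_nonneg (hv₀ i₀ hi₀A) (by linarith)
  have hfeas : ∀ i ∈ A, 0 ≤ b i + ℓ i (v₀ + s • w) := by
    intro i hi
    simp only [map_add, map_smul, smul_eq_mul]
    rcases lt_or_ge (ℓ i w) 0 with h | h
    · have := (le_div_iff₀ (by linarith : 0 < -ℓ i w)).1 (hmin i (mem_filter.2 ⟨hi, h⟩))
      linarith
    · linarith [hv₀ i hi, mul_nonneg hs0 h]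
  have htight : ∀ i ∈ A, b i + ℓ i v₀ = 0 → b i + ℓ i (v₀ + s • w) = 0 := by
    intro i hi h
    simp [hwT i (mem_filter.2 ⟨hi, h⟩), h]
  have hi₀new : b i₀ + ℓ i₀ (v₀ + s • w) = 0 := by
    have : s * (-ℓ i₀ w) = b i₀ + ℓ i₀ v₀ := div_mul_cancel₀ _ (by linarith)
    simp only [map_add, map_smul, smul_eq_mul]
    linarith
  have hssub : T ⊂ {i ∈ A | b i + ℓ i (v₀ + s • w) = 0} := by
    refine (ssubset_iff_of_subset fun i hi => ?_).2
      ⟨i₀, mem_filter.2 ⟨hi₀A, hi₀new⟩, fun h => hi₀w.ne (hwT i₀ h)⟩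
    obtain ⟨hiA, hi0⟩ := mem_filter.1 hi
    exact mem_filter.2 ⟨hiA, htight i hiA hi0⟩
  have hcard := card_lt_card hssub
  have hle := card_filter_le A fun i => b i + ℓ i (v₀ + s • w) = 0
  obtain ⟨v, h1, h2, h3, h4⟩ := ih _ (by omega) (v₀ + s • w) hfeas rfl
  refine ⟨v, h1, h2.trans ?_, fun i hi h => h3 i hi (htight i hi h), h4⟩
  simp only [map_add, map_smul, smul_eq_mul]
  linarith [mul_nonpos_of_nonneg_of_nonpos hs0 hgw]

/-- The linear functional `(w, t) ↦ ⟪w, y⟫ + t`. -/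
noncomputable def liftFunctional {E : Type*} [NormedAddCommGroup E] [InnerProductSpace ℝ E]
    (y : E) : (E × ℝ) →ₗ[ℝ] ℝ :=
  LinearMap.coprod (innerₗ E y) LinearMap.id

theorem liftFunctional_apply {E : Type*} [NormedAddCommGroup E] [InnerProductSpace ℝ E]
    (y : E) (v : E × ℝ) : liftFunctional y v = inner ℝ y v.1 + v.2 := by
  simp [liftFunctional]

/-- The power of `y` with respect to the sphere with center `c` and radius `r` is affine in the
lifted coordinates `(-2c, ‖c‖² - r²)` of the sphere. -/
theorem dist_sq_sub_sq_eq_liftFunctional {E : Type*} [NormedAddCommGroup E]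
    [InnerProductSpace ℝ E] (y c : E) (r : ℝ) :
    dist y c ^ 2 - r ^ 2 =
      ‖y‖ ^ 2 + liftFunctional y ((-2 : ℝ) • c, ‖c‖ ^ 2 - r ^ 2) := by
  rw [liftFunctional_apply, dist_eq_norm, norm_sub_sq_real, real_inner_smul_right]
  ring

theorem liftFunctional_nonneg_of_mem_convexHull {E : Type*} [NormedAddCommGroup E]
    [InnerProductSpace ℝ E] {S : Set E} {v : E × ℝ} (h : ∀ y ∈ S, 0 ≤ liftFunctional y v)
    {z : E} (hz : z ∈ convexHull ℝ S) : 0 ≤ liftFunctional z v := by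
  have hconv : Convex ℝ {y : E | 0 ≤ liftFunctional y v} := by
    intro y hy z hz a b ha hb hab
    simp only [Set.mem_ofPred_eq, liftFunctional_apply, inner_add_left, real_inner_smul_left]
      at hy hz ⊢
    have : v.2 = a * v.2 + b * v.2 := by rw [← add_mul, hab, one_mul]
    linarith [mul_nonneg ha hy, mul_nonneg hb hz]
  exact convexHull_min h hconv hz

theorem eq_zero_of_liftFunctional_eq_zero {E : Type*} [NormedAddCommGroup E]
    [InnerProductSpace ℝ E] {S : Set E} (hS : affineSpan ℝ S = ⊤) {v : E × ℝ}
    (h : ∀ y ∈ S, liftFunctional y v = 0) : v = 0 := by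
  have hall : ∀ z : E, liftFunctional z v = 0 := by
    intro z
    have hz : z ∈ affineSpan ℝ S := hS ▸ AffineSubspace.mem_top ℝ E z
    refine affineSpan_induction (p := fun z => liftFunctional z v = 0) hz h ?_
    intro a y z w hy hz hw
    simp only [liftFunctional_apply, vsub_eq_sub, vadd_eq_add, inner_add_left, inner_sub_left,
      real_inner_smul_left] at hy hz hw ⊢
    linear_combination a * hy - a * hz + hw
  have h2 : v.2 = 0 := by simpa [liftFunctional_apply] using hall 0
  have h1 : v.1 = 0 := by simpa [liftFunctional_apply, h2] using hall v.1
  exact Prod.ext h1 h2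

section GeneralPosition

variable {d n : ℕ} {x : Fin n → EuclideanSpace ℝ (Fin d)}

theorem GenPos.affineSpan_eq_top (hgp : GenPos x) {s : Finset (Fin n)} (hs : #s = d + 1) :
    affineSpan ℝ (Set.range fun i : s => x i) = ⊤ := by
  have hne : s.Nonempty := card_pos.1 (by omega)
  exact ((hgp s hne hs.le).1.affineSpan_eq_top_iff_card_eq_finrank_add_one).2 (by simp [hs])

theorem GenPos.existsUnique_sphere (hgp : GenPos x) {s : Finset (Fin n)} (hs : #s = d + 1) :
    ∃! S : EuclideanGeometry.Sphere (EuclideanSpace ℝ (Fin d)),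
      ∀ i ∈ s, dist (x i) S.center = S.radius := by
  have hne : s.Nonempty := card_pos.1 (by omega)
  have : Nonempty s := hne.to_subtype
  obtain ⟨S, ⟨-, hS⟩, huniq⟩ := (hgp s hne hs.le).1.existsUnique_dist_eq
  refine ⟨S, fun i hi => hS ⟨⟨i, hi⟩, rfl⟩, fun S' hS' => huniq S' ⟨?_, ?_⟩⟩
  · rw [hgp.affineSpan_eq_top hs]
    exact AffineSubspace.mem_top ℝ _ _
  · rintro _ ⟨i, rfl⟩
    exact hS' i i.2

theorem GenPos.card_le_of_cospherical (hgp : GenPos x) {T : Finset (Fin n)}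
    {c : EuclideanSpace ℝ (Fin d)} {r : ℝ} (hT : ∀ i ∈ T, dist (x i) c = r) : #T ≤ d + 1 := by
  by_contra! hlt
  obtain ⟨s, hsT, hs⟩ := exists_subset_card_eq hlt.le
  obtain ⟨j, hjT, hjs⟩ := exists_mem_notMem_of_card_lt_card (hs ▸ hlt)
  refine (hgp s (card_pos.1 (by omega)) hs.le).2 c r
    ⟨fun i hi => hT i (hsT hi), fun c' r' h' => ?_⟩ j hjs (hT j hjT)
  have := (hgp.existsUnique_sphere hs).unique (y₁ := ⟨c, r⟩) (y₂ := ⟨c', r'⟩)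
    (fun i hi => hT i (hsT hi)) h'
  exact (congrArg EuclideanGeometry.Sphere.radius this).le

theorem incrMem_insert {T : Finset (Fin n)} {m : Fin n} (hTm : ∀ i ∈ T, i < m)
    {c : EuclideanSpace ℝ (Fin d)} {r : ℝ} (hT : ∀ i ∈ T, dist (x i) c = r)
    (hm : dist (x m) c ≤ r) (hlt : ∀ i < m, r ≤ dist (x i) c) : IncrMem x (insert m T) := by
  have hmax : (insert m T).max' (insert_nonempty m T) = m :=
    le_antisymm (max'_le _ _ _ fun i hi => (mem_insert.1 hi).elim (·.le) fun h => (hTm i h).le)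
      (le_max' _ _ (mem_insert_self m T))
  refine ⟨insert_nonempty m T, c, r, ?_, ?_, ?_⟩ <;> rw [hmax]
  · intro i hi
    obtain ⟨hne, hi⟩ := mem_erase.1 hi
    exact hT i ((mem_insert.1 hi).resolve_left hne)
  · exact hm
  · exact hlt

/-- An empty sphere enclosing a point of the hull of the first `d + 1` points can be moved, keeping
the points it passes through, until it passes through `d + 1` preceding points. -/
theorem exists_circumsphere_of_enclosing (hgp : GenPos x) (hn : d + 2 ≤ n) (hΔ : DeltaProp x)
    {m : Fin n} (hm : d + 1 ≤ (m : ℕ)) {c : EuclideanSpace ℝ (Fin d)} {r : ℝ} (hr : 0 ≤ r)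
    (hcm : dist (x m) c ≤ r) (hlt : ∀ i < m, r ≤ dist (x i) c) :
    ∃ (T : Finset (Fin n)) (c' : EuclideanSpace ℝ (Fin d)) (r' : ℝ), #T = d + 1 ∧
      (∀ i ∈ T, i < m) ∧ (∀ i < m, dist (x i) c = r → i ∈ T) ∧
      (∀ i ∈ T, dist (x i) c' = r') ∧ dist (x m) c' ≤ r' ∧ ∀ i < m, r' ≤ dist (x i) c' := by
  classical
  have hF : #{i : Fin n | (i : ℕ) < d + 1} = d + 1 := by
    rw [Fin.card_filter_val_lt]
    omega
  have hFm : ∀ i : Fin n, (i : ℕ) < d + 1 → i ∈ Iio m := fun i hi => by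
    rw [mem_Iio, Fin.lt_def]
    omega
  have hmem : x m ∈ convexHull ℝ (x '' {i : Fin n | (i : ℕ) < d + 1}) :=
    hΔ ▸ subset_convexHull ℝ _ (Set.mem_range_self m)
  obtain ⟨⟨w, t⟩, hfeas, hgv, htight, hcard⟩ :=
    exists_feasible_finrank_le_card_tight (Iio m) (fun i => liftFunctional (x i))
      (fun i => ‖x i‖ ^ 2) (liftFunctional (x m))
      (by
        intro v hv
        by_contra! hcon
        refine hv (eq_zero_of_liftFunctional_eq_zero (hgp.affineSpan_eq_top hF) ?_)
        rintro _ ⟨⟨i, hi⟩, rfl⟩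
        exact hcon i (hFm i (by simpa using hi)))
      (by
        intro v hv
        refine liftFunctional_nonneg_of_mem_convexHull ?_ hmem
        rintro _ ⟨i, hi, rfl⟩
        exact hv i (hFm i hi))
      ((-2 : ℝ) • c, ‖c‖ ^ 2 - r ^ 2)
      (by
        intro i hi
        rw [← dist_sq_sub_sq_eq_liftFunctional]
        exact sub_nonneg.2 (pow_le_pow_left₀ hr (hlt i (mem_Iio.1 hi)) 2))
  set T := {i ∈ Iio m | ‖x i‖ ^ 2 + liftFunctional (x i) (w, t) = 0} with hTdef
  set c' : EuclideanSpace ℝ (Fin d) := (-(1 / 2) : ℝ) • w with hc'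
  have hpow : ∀ y, ‖y‖ ^ 2 + liftFunctional y (w, t) = dist y c' ^ 2 - (‖c'‖ ^ 2 - t) := by
    intro y
    rw [liftFunctional_apply, dist_eq_norm, norm_sub_sq_real, hc', real_inner_smul_right]
    ring
  have hTcard : d + 1 ≤ #T := by simpa using hcard
  obtain ⟨j, hj⟩ : T.Nonempty := card_pos.1 (by omega)
  have hjT := (mem_filter.1 hj).2
  rw [hpow] at hjT
  have hrad : ‖c'‖ ^ 2 - t = dist (x j) c' ^ 2 := by linarith
  simp only [hpow, hrad] at hfeas htight hTdef
  have hT : ∀ i ∈ T, dist (x i) c' = dist (x j) c' := by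
    intro i hi
    rw [hTdef] at hi
    exact (pow_left_inj₀ dist_nonneg dist_nonneg two_ne_zero).1 (sub_eq_zero.1 (mem_filter.1 hi).2)
  refine ⟨T, c', dist (x j) c', le_antisymm (hgp.card_le_of_cospherical hT) hTcard,
    fun i hi => mem_Iio.1 (mem_filter.1 hi).1, fun i hi h => ?_, hT, ?_, fun i hi => ?_⟩
  · rw [hTdef]
    refine mem_filter.2 ⟨mem_Iio.2 hi, htight i (mem_Iio.2 hi) ?_⟩
    rw [← dist_sq_sub_sq_eq_liftFunctional, h, sub_self]
  · have h1 := hpow (x m)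
    have h2 := dist_sq_sub_sq_eq_liftFunctional (x m) c r
    have h3 := pow_le_pow_left₀ dist_nonneg hcm 2
    exact (pow_le_pow_iff_left₀ dist_nonneg dist_nonneg two_ne_zero).1 (by linarith)
  · exact (pow_le_pow_iff_left₀ dist_nonneg dist_nonneg two_ne_zero).1
      (sub_nonneg.1 (hfeas i (mem_Iio.2 hi)))

end GeneralPosition

/-- If `|X| ≥ d+2` and `X` has the Δ-property, then every simplex of `I(X)` is a face of a
`(d+1)`-dimensional simplex of `I(X)`; in particular `I(X)` is pure of dimension `d+1`. -/
theorem incr_pure {d n : ℕ} (x : Fin n → EuclideanSpace ℝ (Fin d))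
    (hinj : Function.Injective x) (hgp : GenPos x)
    (hn : d + 2 ≤ n) (hΔ : DeltaProp x) :
    ∀ σ : Finset (Fin n), IncrMem x σ →
      ∃ τ : Finset (Fin n), IncrMem x τ ∧ τ.card = d + 2 ∧ σ ⊆ τ := by
  rintro σ ⟨hσ, c, r, hon, hin, hout⟩
  rcases le_or_gt (d + 1) (σ.max' hσ : ℕ) with hm | hm
  · obtain ⟨T, c', r', hcard, hTm, hsub, hT, hm', hout'⟩ :=
      exists_circumsphere_of_enclosing hgp hn hΔ hm (dist_nonneg.trans hin) hin hout
    refine ⟨insert (σ.max' hσ) T, incrMem_insert hTm hT hm' hout', ?_, fun i hi => ?_⟩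
    · rw [card_insert_of_notMem fun h => (hTm _ h).false, hcard]
    · rcases (le_max' σ i hi).eq_or_lt with h | h
      · exact h ▸ mem_insert_self _ _
      · exact mem_insert_of_mem (hsub i h (hon i (mem_erase.2 ⟨h.ne, hi⟩)))
  · have hF : #{i : Fin n | (i : ℕ) < d + 1} = d + 1 := by
      rw [Fin.card_filter_val_lt]
      omega
    obtain ⟨S, hS, -⟩ := hgp.existsUnique_sphere hF
    have hS' : ∀ i : Fin n, (i : ℕ) < d + 1 → dist (x i) S.center = S.radius :=
      fun i hi => hS i (by simpa using hi)
    refine ⟨insert ⟨d + 1, by omega⟩ (univ.filter fun i : Fin n => (i : ℕ) < d + 1),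
      incrMem_insert (fun i hi => ?_) hS ?_ fun i hi => (hS' i hi).ge, ?_, fun i hi => ?_⟩
    · simpa [Fin.lt_def] using hi
    · have hmem : x ⟨d + 1, by omega⟩ ∈ convexHull ℝ (x '' {i : Fin n | (i : ℕ) < d + 1}) :=
        hΔ ▸ subset_convexHull ℝ _ (Set.mem_range_self _)
      refine convexHull_min ?_ (convex_closedBall S.center S.radius) hmem
      rintro _ ⟨i, hi, rfl⟩
      exact (hS' i hi).le
    · rw [card_insert_of_notMem (by simp), hF]
    · have := Fin.le_def.1 (le_max' σ i hi)
      exact mem_insert_of_mem (mem_filter.2 ⟨mem_univ i, by omega⟩)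
end

section
/- Let S and S' be two (d−1)-spheres in ℝ^d that are both circumspheres of a common affinely independent point set τ' with |τ'| ≤ d. Then there exists a continuous one-parameter family (S_t)_{t∈[0,1]} of circumspheres of τ' with S₀ = S and S₁ = S', whose centers and radii vary continuously in t; moreover, if a point p lies on or inside both S and S', the family can be chosen so that p lies on or inside every S_t. -/
open Set

/-- Stewart's identity for the squared distance to a point of the line through `a` and `b`. -/
theorem dist_sq_lineMap {E : Type*} [NormedAddCommGroup E] [InnerProductSpace ℝ E]
    (x a b : E) (t : ℝ) :
    dist x (AffineMap.lineMap a b t) ^ 2 =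
      (1 - t) * dist x a ^ 2 + t * dist x b ^ 2 - t * (1 - t) * dist a b ^ 2 := by
  have hx : x - AffineMap.lineMap a b t = (1 - t) • (x - a) + t • (x - b) := by
    rw [AffineMap.lineMap_apply_module]
    module
  have hab : a - b = (x - b) - (x - a) := by abel
  rw [dist_eq_norm, dist_eq_norm, dist_eq_norm, dist_eq_norm, hx, hab, norm_add_sq_real,
    norm_sub_sq_real (x - b) (x - a), real_inner_smul_left, real_inner_smul_right, norm_smul, norm_smul,
    mul_pow, mul_pow, Real.norm_eq_abs, Real.norm_eq_abs, sq_abs, sq_abs, real_inner_comm (x - a)]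
  ring

/-- The set of points at least as close to `x` as to `y` contains, with two points, the segment
between them. -/
theorem dist_lineMap_le_dist_lineMap {E : Type*} [NormedAddCommGroup E] [InnerProductSpace ℝ E]
    {x y a b : E} (ha : dist x a ≤ dist y a) (hb : dist x b ≤ dist y b)
    {t : ℝ} (ht : t ∈ Icc (0 : ℝ) 1) :
    dist x (AffineMap.lineMap a b t) ≤ dist y (AffineMap.lineMap a b t) := by
  have ht₀ : 0 ≤ t := ht.1
  have ht₁ : 0 ≤ 1 - t := sub_nonneg.2 ht.2
  refine le_of_sq_le_sq ?_ dist_nonneg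
  rw [dist_sq_lineMap, dist_sq_lineMap]
  gcongr

/-- Along the segment between the centers of two circumspheres of `s`, there is a continuous choice
of circumspheres of `s` whose balls all contain the intersection of the two given balls. -/
theorem exists_continuous_radius_lineMap {E : Type*} [NormedAddCommGroup E]
    [InnerProductSpace ℝ E] {s : Set E} {c c' : E} {r r' : ℝ}
    (hS : ∀ q ∈ s, dist q c = r) (hS' : ∀ q ∈ s, dist q c' = r') :
    ∃ R : ℝ → ℝ, Continuous R ∧ R 0 = r ∧ R 1 = r' ∧
      (∀ t ∈ Icc (0 : ℝ) 1, ∀ q ∈ s, dist q (AffineMap.lineMap c c' t) = R t) ∧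
      ∀ p, dist p c ≤ r → dist p c' ≤ r' →
        ∀ t ∈ Icc (0 : ℝ) 1, dist p (AffineMap.lineMap c c' t) ≤ R t := by
  rcases s.eq_empty_or_nonempty with rfl | ⟨q₀, hq₀⟩
  · refine ⟨fun t => (1 - t) * r + t * r', by fun_prop, by simp, by simp, by simp, ?_⟩
    intro p hp hp' t ht
    have ht₁ : 0 ≤ 1 - t := sub_nonneg.2 ht.2
    have hconv := (convexOn_univ_dist p).2 (mem_univ c) (mem_univ c') ht₁ ht.1 (by ring)
    rw [AffineMap.lineMap_apply_module, dist_comm]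
    simp only [smul_eq_mul, dist_comm _ p] at hconv ⊢
    exact hconv.trans (add_le_add (mul_le_mul_of_nonneg_left hp ht₁)
      (mul_le_mul_of_nonneg_left hp' ht.1))
  · refine ⟨fun t => dist q₀ (AffineMap.lineMap c c' t),
      continuous_const.dist AffineMap.lineMap_continuous, by simp [hS q₀ hq₀],
      by simp [hS' q₀ hq₀], fun t ht q hq => ?_, fun p hp hp' t ht => ?_⟩
    · have h : dist q c = dist q₀ c := (hS q hq).trans (hS q₀ hq₀).symm
      have h' : dist q c' = dist q₀ c' := (hS' q hq).trans (hS' q₀ hq₀).symm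
      exact le_antisymm (dist_lineMap_le_dist_lineMap h.le h'.le ht)
        (dist_lineMap_le_dist_lineMap h.ge h'.ge ht)
    · exact dist_lineMap_le_dist_lineMap (hp.trans (hS q₀ hq₀).ge) (hp'.trans (hS' q₀ hq₀).ge) ht

/-- Pencil of circumspheres: any two circumspheres of a common affinely independent point set
`τ'` with at most `d` points are connected by a continuous family of circumspheres of `τ'`;
moreover, if a point `p` lies on or inside both spheres, the family can be chosen so that `p`
lies on or inside every sphere of the family. -/
theorem circumsphere_pencil {d : ℕ}
    (τ' : Finset (EuclideanSpace ℝ (Fin d)))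
    (hindep : AffineIndependent ℝ (fun q : τ' => (q : EuclideanSpace ℝ (Fin d))))
    (hcard : τ'.card ≤ d)
    (c c' : EuclideanSpace ℝ (Fin d)) (r r' : ℝ) (hr : 0 ≤ r) (hr' : 0 ≤ r')
    (hS : ∀ q ∈ τ', dist q c = r) (hS' : ∀ q ∈ τ', dist q c' = r') :
    (∃ (C : ℝ → EuclideanSpace ℝ (Fin d)) (R : ℝ → ℝ),
      ContinuousOn C (Icc 0 1) ∧ ContinuousOn R (Icc 0 1) ∧
      C 0 = c ∧ C 1 = c' ∧ R 0 = r ∧ R 1 = r' ∧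
      ∀ t ∈ Icc (0:ℝ) 1, ∀ q ∈ τ', dist q (C t) = R t) ∧
    (∀ p : EuclideanSpace ℝ (Fin d), dist p c ≤ r → dist p c' ≤ r' →
      ∃ (C : ℝ → EuclideanSpace ℝ (Fin d)) (R : ℝ → ℝ),
        ContinuousOn C (Icc 0 1) ∧ ContinuousOn R (Icc 0 1) ∧
        C 0 = c ∧ C 1 = c' ∧ R 0 = r ∧ R 1 = r' ∧
        (∀ t ∈ Icc (0:ℝ) 1, ∀ q ∈ τ', dist q (C t) = R t) ∧
        ∀ t ∈ Icc (0:ℝ) 1, dist p (C t) ≤ R t) := by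
  obtain ⟨R, hR, hR₀, hR₁, hRτ, hRp⟩ :=
    exists_continuous_radius_lineMap (s := (τ' : Set (EuclideanSpace ℝ (Fin d)))) hS hS'
  have hC : Continuous (AffineMap.lineMap c c' : ℝ → EuclideanSpace ℝ (Fin d)) :=
    AffineMap.lineMap_continuous
  exact ⟨⟨AffineMap.lineMap c c', R, hC.continuousOn, hR.continuousOn,
      AffineMap.lineMap_apply_zero c c', AffineMap.lineMap_apply_one c c', hR₀, hR₁, hRτ⟩,
    fun p hp hp' => ⟨AffineMap.lineMap c c', R, hC.continuousOn, hR.continuousOn,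
      AffineMap.lineMap_apply_zero c c', AffineMap.lineMap_apply_one c c', hR₀, hR₁, hRτ,
      hRp p hp hp'⟩⟩
end
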